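/- Let (V, ω) be a finite-dimensional real symplectic vector space (ω a nondegenerate antisymmetric bilinear form), let W ⊆ V be a subspace and F ⊆ W a subspace. Let ω♭ : V → V* denote the isomorphism ω♭(X) = ω(X,·), and on V × V* define J(X,ξ) := (−(ω♭)⁻¹(ξ), ω♭(X)). Let K := F × Ann(W) ⊆ V × V*, where Ann(W) = {ξ ∈ V* : ξ(w) = 0 for all w ∈ W}. Then J(K) ⊆ K if and only if F = W^ω, where W^ω = {X ∈ V : ω(X,Y) = 0 for all Y ∈ W}; and in that case W^ω ⊆ W, i.e. W is a coisotropic subspace of (V, ω). -/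

import Mathlib

/-- The `B`-orthogonal of a subspace `S`:
`orthB B S = {v | ∀ s ∈ S, B v s = 0}`. -/
def orthB {V : Type*} [AddCommGroup V] [Module ℝ V]
    (B : V →ₗ[ℝ] V →ₗ[ℝ] ℝ) (S : Submodule ℝ V) : Submodule ℝ V :=
  ⨅ s ∈ S, LinearMap.ker (B.flip s)

theorem mem_orthB {V : Type*} [AddCommGroup V] [Module ℝ V]
    {B : V →ₗ[ℝ] V →ₗ[ℝ] ℝ} {S : Submodule ℝ V} {v : V} :
    v ∈ orthB B S ↔ ∀ s ∈ S, B v s = 0 := by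
  simp [orthB, Submodule.mem_iInf]

theorem stmt15
    {V : Type*} [AddCommGroup V] [Module ℝ V] [FiniteDimensional ℝ V]
    -- ω is a symplectic form on V
    (ω : V →ₗ[ℝ] V →ₗ[ℝ] ℝ)
    (hanti : ∀ x y : V, ω x y = -ω y x)
    (hnd : ∀ x : V, (∀ y : V, ω x y = 0) → x = 0)
    -- ω♭ : V ≃ V*, ω♭(X) = ω(X, ·)
    (ωb : V ≃ₗ[ℝ] Module.Dual ℝ V)
    (hωb : ∀ x y : V, ωb x y = ω x y)
    -- subspaces F ⊆ W ⊆ V and K = F × Ann(W)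
    (W F : Submodule ℝ V) (hFW : F ≤ W)
    (K : Submodule ℝ (V × Module.Dual ℝ V))
    (hKdef : K = F.prod W.dualAnnihilator)
    -- J(X, ξ) = (−(ω♭)⁻¹(ξ), ω♭(X))
    (J : V × Module.Dual ℝ V → V × Module.Dual ℝ V)
    (hJ : ∀ p : V × Module.Dual ℝ V, J p = (-(ωb.symm p.2), ωb p.1)) :
    -- J(K) ⊆ K iff F = W^ω; and in that case W is coisotropic, i.e. W^ω ⊆ W
    ((∀ p ∈ K, J p ∈ K) ↔ F = orthB ω W) ∧
    (F = orthB ω W → orthB ω W ≤ W) := by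
  have hmem : ∀ x : V, ωb x ∈ W.dualAnnihilator ↔ x ∈ orthB ω W := fun x => by
    simp [Submodule.mem_dualAnnihilator, mem_orthB, hωb]
  subst hKdef
  refine ⟨⟨fun h => le_antisymm (fun x hx => ?_) (fun x hx => ?_), ?_⟩, fun h => h ▸ hFW⟩
  · have hJx := h (x, 0) ⟨hx, zero_mem _⟩
    rw [hJ] at hJx
    exact (hmem x).1 hJx.2
  · have hJx := h (0, ωb x) ⟨zero_mem _, (hmem x).2 hx⟩
    rw [hJ] at hJx
    simpa using hJx.1
  · rintro rfl ⟨x, ξ⟩ ⟨hx, hξ⟩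
    rw [hJ]
    exact ⟨neg_mem ((hmem _).1 (by simpa using hξ)), (hmem x).2 hx⟩
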